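/- arXiv:2306.05009 — 2 statements merged into one kernel-verified Lean document; each statement's English description precedes it below -/
import Mathlib

section
/- Let k be an odd integer and s ∈ (0, π). Then the Gaussian hypergeometric series ∑_{n=0}^∞ [(1)_n·(−k/2−1)_n/((−k/2+2)_n · n!)]·e^{i2ns} (i.e. ₂F₁(1, −k/2−1; −k/2+2; e^{i2s})) is absolutely convergent and equals χ_{(−∞,−1]}(k) − k(4−k²)·e^{iks}·[ ∑_{n=0}^{(|k|−1)/2} e^{−i·sgn(k)·(2n+1)s}/((2n−1)(2n+1)(2n+3)) + (1/4)·cos(s) + (iπ/8)·sin²(s) + (1/4)·sin²(s)·ln(cot(s/2)) ], where χ_{(−∞,−1]}(k) equals 1 if k ≤ −1 and 0 otherwise, and sgn(k) = k/|k|. -/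
theorem hasSum_pow_odd_div {w : ℂ} (hw : ‖w‖ < 1) :
    HasSum (fun n : ℕ => w ^ (2 * n + 1) / (2 * (n : ℂ) + 1))
      ((Complex.log (1 + w) - Complex.log (1 - w)) / 2) := by
  have hn : ‖-(Complex.I * w)‖ < 1 := by simpa using hw
  have hI : -(Complex.I * w) * Complex.I = w := by
    linear_combination -w * Complex.I_mul_I
  have h := (Complex.hasSum_arctan hn).mul_left Complex.I
  rw [Complex.arctan, ← Complex.hasSum_arctan_aux hn, hI] at h
  convert! h using 1
  · funext n
    have : (-(Complex.I * w)) ^ (2 * n + 1) = -(Complex.I * w) * ((-1) ^ n * w ^ (2 * n)) := by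
      rw [pow_succ', pow_mul, neg_sq, mul_pow, Complex.I_sq, mul_pow, pow_mul w]
    rw [this]
    have h1 : ((-1 : ℂ) ^ n) * (-1) ^ n = 1 := by rw [← mul_pow]; simp
    push_cast
    rw [← mul_div_assoc]
    congr 1
    linear_combination (-w ^ (2 * n + 1)) * h1 + w ^ (2 * n + 1) * ((-1 : ℂ) ^ n) * (-1) ^ n * Complex.I_mul_I
  · linear_combination ((Complex.log (1 + w) - Complex.log (1 - w)) / 2) * Complex.I_mul_I

theorem two_mul_intCast_add_one_ne_zero (m : ℤ) : 2 * (m : ℂ) + 1 ≠ 0 := by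
  have : (2 * m + 1 : ℤ) ≠ 0 := by omega
  exact_mod_cast this

/-- Inside the unit disc, the odd power series with coefficients `1/((2n-1)(2n+1)(2n+3))`. -/
theorem hasSum_pow_odd_div_three {w : ℂ} (hw : ‖w‖ < 1) (hw0 : w ≠ 0) :
    HasSum (fun n : ℕ => w ^ (2 * n + 1) /
        ((2 * (n : ℂ) - 1) * (2 * (n : ℂ) + 1) * (2 * (n : ℂ) + 3)))
      (((w - w⁻¹) ^ 2 * ((Complex.log (1 + w) - Complex.log (1 - w)) / 2) - w - w⁻¹) / 8) := by
  have h := hasSum_pow_odd_div hw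
  set A := (Complex.log (1 + w) - Complex.log (1 - w)) / 2
  have hlow : HasSum (fun n : ℕ => w ^ (2 * n + 1) / (2 * (n : ℂ) - 1)) (w ^ 2 * A - w) := by
    rw [show w ^ 2 * A - w = w ^ 2 * A + ∑ i ∈ Finset.range 1,
      w ^ (2 * i + 1) / (2 * (i : ℂ) - 1) by simp; ring, ← hasSum_nat_add_iff]
    convert! h.mul_left (w ^ 2) using 2 with n
    push_cast
    rw [← mul_div_assoc]
    congr 1 <;> ring
  have hhigh : HasSum (fun n : ℕ => w ^ (2 * n + 1) / (2 * (n : ℂ) + 3))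
      ((w⁻¹) ^ 2 * (A - w)) := by
    have h1 : HasSum (fun n : ℕ => w ^ (2 * (n + 1) + 1) / (2 * ((n + 1 : ℕ) : ℂ) + 1)) (A - w) := by
      refine (hasSum_nat_add_iff (f := fun n : ℕ => w ^ (2 * n + 1) / (2 * (n : ℂ) + 1)) 1).2 ?_
      simpa using h
    convert! h1.mul_left ((w⁻¹) ^ 2) using 2 with n
    push_cast
    rw [← mul_div_assoc]
    congr 1
    · field_simp
      ring
    · ring
  convert! ((hlow.sub (h.mul_left 2)).add hhigh).div_const 8 using 1
  · funext n
    have h1 : 2 * (n : ℂ) - 1 ≠ 0 := by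
      have := two_mul_intCast_add_one_ne_zero (n - 1); push_cast at this
      intro h; apply this; linear_combination h
    have h2 : 2 * (n : ℂ) + 1 ≠ 0 := mod_cast two_mul_intCast_add_one_ne_zero n
    have h3 : 2 * (n : ℂ) + 3 ≠ 0 := by
      have := two_mul_intCast_add_one_ne_zero (n + 1); push_cast at this
      intro h; apply this; linear_combination h
    field_simp
    ring
  · field_simp
    ring

theorem norm_pow_odd_div_three_le {w : ℂ} (hw : ‖w‖ ≤ 1) (n : ℕ) :
    ‖w ^ (2 * n + 1) / ((2 * (n : ℂ) - 1) * (2 * (n : ℂ) + 1) * (2 * (n : ℂ) + 3))‖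
      ≤ 1 / ((n + 1 : ℕ) : ℝ) ^ 2 := by
  have h1 : (1 : ℝ) ≤ |2 * (n : ℝ) - 1| := by
    have : (1 : ℤ) ≤ |2 * (n : ℤ) - 1| := Int.one_le_abs (by omega)
    exact_mod_cast this
  have hc : (2 * (n : ℂ) - 1) * (2 * (n : ℂ) + 1) * (2 * (n : ℂ) + 3) =
      (((2 * (n : ℝ) - 1) * ((2 * (n : ℝ) + 1) * (2 * (n : ℝ) + 3)) : ℝ) : ℂ) := by
    push_cast; ring
  have hn : (0 : ℝ) ≤ n := n.cast_nonneg
  rw [hc, norm_div, norm_pow, Complex.norm_real, Real.norm_eq_abs, abs_mul,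
    abs_of_pos (a := (2 * (n : ℝ) + 1) * (2 * (n : ℝ) + 3)) (by positivity)]
  have h2 : (((n + 1 : ℕ) : ℝ)) ^ 2 ≤ (2 * (n : ℝ) + 1) * (2 * (n : ℝ) + 3) := by
    push_cast; nlinarith
  gcongr
  · exact pow_le_one₀ (norm_nonneg _) hw
  · nlinarith [sq_nonneg (((n + 1 : ℕ) : ℝ))]

theorem summable_one_div_succ_sq : Summable fun n : ℕ => 1 / ((n + 1 : ℕ) : ℝ) ^ 2 :=
  (summable_nat_add_iff (f := fun n : ℕ => 1 / (n : ℝ) ^ 2) 1).2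
    (Real.summable_one_div_nat_pow.2 one_lt_two)

/-- The closed form extends to the unit circle away from `±1`. -/
theorem hasSum_pow_odd_div_three_of_norm_eq_one {z : ℂ} (hz : ‖z‖ = 1)
    (h1 : 1 + z ∈ Complex.slitPlane) (h2 : 1 - z ∈ Complex.slitPlane) :
    HasSum (fun n : ℕ => z ^ (2 * n + 1) /
        ((2 * (n : ℂ) - 1) * (2 * (n : ℂ) + 1) * (2 * (n : ℂ) + 3)))
      (((z - z⁻¹) ^ 2 * ((Complex.log (1 + z) - Complex.log (1 - z)) / 2) - z - z⁻¹) / 8) := by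
  have hz0 : z ≠ 0 := by rintro rfl; simp at hz
  have hsum : Summable (fun n : ℕ => z ^ (2 * n + 1) /
      ((2 * (n : ℂ) - 1) * (2 * (n : ℂ) + 1) * (2 * (n : ℂ) + 3))) :=
    .of_norm_bounded summable_one_div_succ_sq (norm_pow_odd_div_three_le hz.le)
  have hcont : ContinuousOn (fun w : ℂ => ∑' n : ℕ, w ^ (2 * n + 1) /
      ((2 * (n : ℂ) - 1) * (2 * (n : ℂ) + 1) * (2 * (n : ℂ) + 3))) (Metric.closedBall 0 1) :=
    continuousOn_tsum (fun n => by fun_prop) summable_one_div_succ_sq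
      fun n w hw => norm_pow_odd_div_three_le (by simpa using hw) n
  have hray : Filter.Tendsto (fun r : ℝ => (r : ℂ) * z) (nhdsWithin 1 (Set.Ioo 0 1)) (nhds z) := by
    have : Continuous fun r : ℝ => (r : ℂ) * z := by fun_prop
    simpa using (this.tendsto 1).mono_left nhdsWithin_le_nhds
  have hmem : ∀ᶠ r : ℝ in nhdsWithin 1 (Set.Ioo 0 1), ‖(r : ℂ) * z‖ < 1 ∧ (r : ℂ) * z ≠ 0 := by
    filter_upwards [self_mem_nhdsWithin] with r hr
    refine ⟨?_, mul_ne_zero (by exact_mod_cast hr.1.ne') hz0⟩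
    rw [norm_mul, hz, mul_one, Complex.norm_real, Real.norm_eq_abs, abs_of_pos hr.1]
    exact hr.2
  have hL := (hcont z (by simp [hz])).tendsto.comp (tendsto_nhdsWithin_iff.2
    ⟨hray, hmem.mono fun r hr => by simpa using hr.1.le⟩)
  have hcR : ContinuousAt (fun w : ℂ => ((w - w⁻¹) ^ 2 *
      ((Complex.log (1 + w) - Complex.log (1 - w)) / 2) - w - w⁻¹) / 8) z := by
    fun_prop (disch := assumption)
  have hR := hcR.tendsto.comp hray
  have hne : (nhdsWithin (1 : ℝ) (Set.Ioo 0 1)).NeBot := right_nhdsWithin_Ioo_neBot zero_lt_one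
  have := tendsto_nhds_unique (hL.congr' (hmem.mono fun r hr =>
    (hasSum_pow_odd_div_three hr.1 hr.2).tsum_eq)) hR
  rw [← this]
  exact hsum.hasSum

theorem one_add_exp_mul_I (s : ℝ) : 1 + Complex.exp (s * Complex.I) =
    ((2 * Real.cos (s / 2) : ℝ) : ℂ) * Complex.exp (((s / 2 : ℝ) : ℂ) * Complex.I) := by
  push_cast
  rw [Complex.two_cos, add_mul, ← Complex.exp_add, ← Complex.exp_add,
    show (s : ℂ) / 2 * Complex.I + s / 2 * Complex.I = s * Complex.I by ring,
    show -((s : ℂ) / 2) * Complex.I + s / 2 * Complex.I = 0 by ring, Complex.exp_zero, add_comm]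

theorem log_one_add_exp_mul_I {s : ℝ} (h0 : -Real.pi < s) (h1 : s < Real.pi) :
    Complex.log (1 + Complex.exp (s * Complex.I)) =
      (Real.log (2 * Real.cos (s / 2)) : ℂ) + ((s / 2 : ℝ) : ℂ) * Complex.I := by
  have hc : 0 < Real.cos (s / 2) := Real.cos_pos_of_mem_Ioo ⟨by linarith, by linarith⟩
  have hpi := Real.pi_pos
  rw [one_add_exp_mul_I, Complex.log_ofReal_mul (by positivity) (Complex.exp_ne_zero _),
    Complex.log_exp]
  · simp; linarith
  · simp; linarith

theorem log_one_sub_exp_mul_I {s : ℝ} (h0 : 0 < s) (h1 : s < 2 * Real.pi) :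
    Complex.log (1 - Complex.exp (s * Complex.I)) =
      (Real.log (2 * Real.sin (s / 2)) : ℂ) + ((s / 2 - Real.pi / 2 : ℝ) : ℂ) * Complex.I := by
  have h := log_one_add_exp_mul_I (s := s - Real.pi) (by linarith) (by linarith)
  have he : Complex.exp (((s - Real.pi : ℝ) : ℂ) * Complex.I) = -Complex.exp (s * Complex.I) := by
    push_cast
    rw [sub_mul, Complex.exp_sub, Complex.exp_pi_mul_I, div_neg, div_one]
  rwa [he, ← sub_eq_add_neg, sub_div, Real.cos_sub_pi_div_two] at h

theorem log_one_add_exp_sub_log_one_sub_exp {s : ℝ} (hs : s ∈ Set.Ioo 0 Real.pi) :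
    Complex.log (1 + Complex.exp (s * Complex.I)) - Complex.log (1 - Complex.exp (s * Complex.I)) =
      (Real.log (Real.cot (s / 2)) : ℂ) + Real.pi / 2 * Complex.I := by
  have hpi := Real.pi_pos
  have hc : 0 < Real.cos (s / 2) :=
    Real.cos_pos_of_mem_Ioo ⟨by linarith [hs.1], by linarith [hs.2]⟩
  have hsin : 0 < Real.sin (s / 2) :=
    Real.sin_pos_of_mem_Ioo ⟨by linarith [hs.1], by linarith [hs.2]⟩
  rw [log_one_add_exp_mul_I (by linarith [hs.1]) hs.2,
    log_one_sub_exp_mul_I hs.1 (by linarith [hs.2]), Real.cot_eq_cos_div_sin,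
    Real.log_div hc.ne' hsin.ne', Real.log_mul two_ne_zero hc.ne',
    Real.log_mul two_ne_zero hsin.ne']
  push_cast
  ring

theorem hasSum_exp_odd_div_three {s : ℝ} (hs : s ∈ Set.Ioo 0 Real.pi) :
    HasSum (fun n : ℕ => Complex.exp (s * Complex.I) ^ (2 * n + 1) /
        ((2 * (n : ℂ) - 1) * (2 * (n : ℂ) + 1) * (2 * (n : ℂ) + 3)))
      (-((1 / 4 : ℂ) * (Real.cos s : ℂ)
            + Complex.I * (Real.pi : ℂ) / 8 * (Real.sin s : ℂ) ^ 2
            + (1 / 4 : ℂ) * (Real.sin s : ℂ) ^ 2 * (Real.log (Real.cot (s / 2)) : ℂ))) := by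
  have hlt : Real.cos s < 1 := by
    simpa using Real.cos_lt_cos_of_nonneg_of_le_pi le_rfl hs.2.le hs.1
  have hgt : -1 < Real.cos s := by
    simpa using Real.cos_lt_cos_of_nonneg_of_le_pi hs.1.le le_rfl hs.2
  have h := hasSum_pow_odd_div_three_of_norm_eq_one (Complex.norm_exp_ofReal_mul_I s)
    (Or.inl (by simp only [Complex.add_re, Complex.one_re, Complex.exp_ofReal_mul_I_re]; linarith))
    (Or.inl (by simp only [Complex.sub_re, Complex.one_re, Complex.exp_ofReal_mul_I_re]; linarith))
  rw [log_one_add_exp_sub_log_one_sub_exp hs, ← Complex.exp_neg, ← neg_mul, Complex.exp_mul_I,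
    Complex.exp_mul_I, Complex.cos_neg, Complex.sin_neg, ← Complex.exp_mul_I] at h
  convert! h using 1
  push_cast
  rw [Complex.exp_mul_I]
  linear_combination (-Complex.sin s ^ 2 * (Real.log (Real.cot (s / 2)) +
    Real.pi / 2 * Complex.I) / 4) * Complex.I_sq

/-- The tail of the odd series, starting at index `2 * p + 1`. -/
theorem hasSum_exp_of_pos_start {s : ℝ} {G : ℂ} (p : ℕ)
    (hG : HasSum (fun n : ℕ => Complex.exp (s * Complex.I) ^ (2 * n + 1) /
        ((2 * (n : ℂ) - 1) * (2 * (n : ℂ) + 1) * (2 * (n : ℂ) + 3))) G) :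
    HasSum (fun n : ℕ => Complex.exp (Complex.I * (2 * n + (2 * p + 1)) * s) /
        ((2 * (n : ℂ) + (2 * p + 1) - 2) * (2 * (n : ℂ) + (2 * p + 1)) *
          (2 * (n : ℂ) + (2 * p + 1) + 2)))
      (G - ∑ n ∈ Finset.range p, Complex.exp (Complex.I * (2 * n + 1) * s) /
        ((2 * (n : ℂ) - 1) * (2 * (n : ℂ) + 1) * (2 * (n : ℂ) + 3))) := by
  have hpow (n : ℕ) : Complex.exp (s * Complex.I) ^ (2 * n + 1) =
      Complex.exp (Complex.I * (2 * n + 1) * s) := by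
    rw [← Complex.exp_nat_mul]; push_cast; ring_nf
  simp only [hpow] at hG
  have h := (hasSum_nat_add_iff (f := fun n : ℕ => Complex.exp (Complex.I * (2 * n + 1) * s) /
    ((2 * (n : ℂ) - 1) * (2 * (n : ℂ) + 1) * (2 * (n : ℂ) + 3))) (g := G - ∑ n ∈ Finset.range p,
    Complex.exp (Complex.I * (2 * n + 1) * s) /
      ((2 * (n : ℂ) - 1) * (2 * (n : ℂ) + 1) * (2 * (n : ℂ) + 3))) p).2 (by simpa using hG)
  convert! h using 2 with n
  push_cast
  congr 1 <;> ring_nf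

/-- The odd series extended to the left, starting at index `-(2 * p + 1)`. -/
theorem hasSum_exp_of_neg_start {s : ℝ} {G : ℂ} (p : ℕ)
    (hG : HasSum (fun n : ℕ => Complex.exp (s * Complex.I) ^ (2 * n + 1) /
        ((2 * (n : ℂ) - 1) * (2 * (n : ℂ) + 1) * (2 * (n : ℂ) + 3))) G) :
    HasSum (fun n : ℕ => Complex.exp (Complex.I * (2 * n - (2 * p + 1)) * s) /
        ((2 * (n : ℂ) - (2 * p + 1) - 2) * (2 * (n : ℂ) - (2 * p + 1)) *
          (2 * (n : ℂ) - (2 * p + 1) + 2)))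
      (G - ∑ n ∈ Finset.range (p + 1), Complex.exp (-Complex.I * (2 * n + 1) * s) /
        ((2 * (n : ℂ) - 1) * (2 * (n : ℂ) + 1) * (2 * (n : ℂ) + 3))) := by
  set f : ℕ → ℂ := fun n => Complex.exp (Complex.I * (2 * n - (2 * p + 1)) * s) /
        ((2 * (n : ℂ) - (2 * p + 1) - 2) * (2 * (n : ℂ) - (2 * p + 1)) *
          (2 * (n : ℂ) - (2 * p + 1) + 2)) with hf
  have hfin : -∑ n ∈ Finset.range (p + 1), Complex.exp (-Complex.I * (2 * n + 1) * s) /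
        ((2 * (n : ℂ) - 1) * (2 * (n : ℂ) + 1) * (2 * (n : ℂ) + 3)) =
      ∑ n ∈ Finset.range (p + 1), f n := by
    rw [← Finset.sum_range_reflect f, ← Finset.sum_neg_distrib]
    refine Finset.sum_congr rfl fun n hn => ?_
    have hnp : n ≤ p := Nat.lt_succ_iff.1 (Finset.mem_range.1 hn)
    simp only [hf, Nat.add_sub_cancel, Nat.cast_sub hnp]
    rw [← div_neg]
    congr 1 <;> ring_nf
  rw [sub_eq_add_neg, hfin, ← hasSum_nat_add_iff]
  convert! hG using 2 with n
  rw [hf, ← Complex.exp_nat_mul]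
  push_cast
  congr 1 <;> ring_nf

theorem ascPochhammer_eval_mul_add_three (n : ℕ) (a : ℂ) :
    (ascPochhammer ℂ n).eval a * ((a + n) * (a + n + 1) * (a + n + 2)) =
      a * (a + 1) * (a + 2) * (ascPochhammer ℂ n).eval (a + 3) := by
  induction n with
  | zero => simp
  | succ n ih =>
    rw [ascPochhammer_succ_eval, ascPochhammer_succ_eval]
    push_cast
    linear_combination (a + 3 + n) * ih

theorem hypergeometric_term_eq {k : ℤ} (hk : Odd k) (s : ℝ) (n : ℕ) :
    (ascPochhammer ℂ n).eval 1 * (ascPochhammer ℂ n).eval (-(k : ℂ) / 2 - 1)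
        / ((ascPochhammer ℂ n).eval (-(k : ℂ) / 2 + 2) * (n.factorial : ℂ))
        * Complex.exp (Complex.I * 2 * (s : ℂ)) ^ n =
      (k : ℂ) * (4 - (k : ℂ) ^ 2) * Complex.exp (Complex.I * (k : ℂ) * (s : ℂ)) *
        (Complex.exp (Complex.I * (2 * n - k) * s) /
          ((2 * (n : ℂ) - k - 2) * (2 * (n : ℂ) - k) * (2 * (n : ℂ) - k + 2))) := by
  have hodd (m : ℤ) : 2 * (m : ℂ) - k ≠ 0 := by
    obtain ⟨j, rfl⟩ := hk
    have h := two_mul_intCast_add_one_ne_zero (j - m)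
    push_cast at h ⊢
    intro h'; apply h; linear_combination -h'
  have hpoch : (ascPochhammer ℂ n).eval (-(k : ℂ) / 2 + 2) ≠ 0 := by
    rw [Ne, ascPochhammer_eval_eq_zero_iff]
    rintro ⟨m, -, hm⟩
    refine hodd (m + 2) ?_
    push_cast
    linear_combination 2 * hm
  have hfact : (n.factorial : ℂ) ≠ 0 := Nat.cast_ne_zero.2 n.factorial_ne_zero
  have h0 : 2 * (n : ℂ) - k ≠ 0 := hodd n
  have h1 : 2 * (n : ℂ) - k - 2 ≠ 0 := by
    have := hodd (n - 1); push_cast at this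
    intro h; apply this; linear_combination h
  have h2 : 2 * (n : ℂ) - k + 2 ≠ 0 := by
    have := hodd (n + 1); push_cast at this
    intro h; apply this; linear_combination h
  have hrec := ascPochhammer_eval_mul_add_three n (-(k : ℂ) / 2 - 1)
  rw [show -(k : ℂ) / 2 - 1 + 3 = -(k : ℂ) / 2 + 2 by ring] at hrec
  have hexp : Complex.exp (Complex.I * 2 * (s : ℂ)) ^ n =
      Complex.exp (Complex.I * (k : ℂ) * (s : ℂ)) * Complex.exp (Complex.I * (2 * n - k) * s) := by
    rw [← Complex.exp_nat_mul, ← Complex.exp_add]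
    ring_nf
  have hratio : (ascPochhammer ℂ n).eval (-(k : ℂ) / 2 - 1) /
      (ascPochhammer ℂ n).eval (-(k : ℂ) / 2 + 2) = (k : ℂ) * (4 - (k : ℂ) ^ 2) /
        ((2 * (n : ℂ) - k - 2) * (2 * (n : ℂ) - k) * (2 * (n : ℂ) - k + 2)) := by
    rw [div_eq_div_iff hpoch (by positivity)]
    linear_combination 8 * hrec
  rw [ascPochhammer_eval_one, mul_comm (n.factorial : ℂ), mul_div_mul_right _ _ hfact, hratio, hexp]
  ring


/-- For `k` odd and `s ∈ (0, π)`, the Gaussian hypergeometric series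
`₂F₁(1, −k/2−1; −k/2+2; e^{i2s})` converges absolutely and equals
`χ_{(−∞,−1]}(k) − k(4−k²)e^{iks}[∑_{n=0}^{(|k|−1)/2} e^{−i·sgn(k)(2n+1)s}/((2n−1)(2n+1)(2n+3))
 + (1/4)cos s + (iπ/8)sin² s + (1/4)sin² s·ln(cot(s/2))]`. -/
theorem hypergeometric_2F1_odd_k (k : ℤ) (hk : Odd k) (s : ℝ) (hs : s ∈ Set.Ioo 0 Real.pi) :
    Summable (fun n : ℕ => ‖(ascPochhammer ℂ n).eval 1
        * (ascPochhammer ℂ n).eval (-(k : ℂ) / 2 - 1)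
        / ((ascPochhammer ℂ n).eval (-(k : ℂ) / 2 + 2) * (n.factorial : ℂ))
        * Complex.exp (Complex.I * 2 * (s : ℂ)) ^ n‖)
    ∧ (∑' n : ℕ, (ascPochhammer ℂ n).eval 1
        * (ascPochhammer ℂ n).eval (-(k : ℂ) / 2 - 1)
        / ((ascPochhammer ℂ n).eval (-(k : ℂ) / 2 + 2) * (n.factorial : ℂ))
        * Complex.exp (Complex.I * 2 * (s : ℂ)) ^ n)
      = (if k ≤ -1 then (1 : ℂ) else 0)
        - (k : ℂ) * (4 - (k : ℂ) ^ 2) * Complex.exp (Complex.I * (k : ℂ) * (s : ℂ)) *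
          ((∑ n ∈ Finset.range ((k.natAbs - 1) / 2 + 1),
              Complex.exp (-Complex.I * (k.sign : ℂ) * (2 * (n : ℂ) + 1) * (s : ℂ))
                / ((2 * (n : ℂ) - 1) * (2 * (n : ℂ) + 1) * (2 * (n : ℂ) + 3)))
            + (1 / 4 : ℂ) * (Real.cos s : ℂ)
            + Complex.I * (Real.pi : ℂ) / 8 * (Real.sin s : ℂ) ^ 2
            + (1 / 4 : ℂ) * (Real.sin s : ℂ) ^ 2 * (Real.log (Real.cot (s / 2)) : ℂ)) := by
  set K : ℂ := (k : ℂ) * (4 - (k : ℂ) ^ 2) * Complex.exp (Complex.I * (k : ℂ) * (s : ℂ)) with hK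
  have hG := hasSum_exp_odd_div_three hs
  set C : ℂ := (1 / 4 : ℂ) * (Real.cos s : ℂ)
            + Complex.I * (Real.pi : ℂ) / 8 * (Real.sin s : ℂ) ^ 2
            + (1 / 4 : ℂ) * (Real.sin s : ℂ) ^ 2 * (Real.log (Real.cot (s / 2)) : ℂ) with hC
  simp only [hypergeometric_term_eq hk]
  rw [add_assoc, add_assoc, ← add_assoc ((1 / 4 : ℂ) * _), ← hC, ← hK]
  suffices h : HasSum (fun n : ℕ => K * (Complex.exp (Complex.I * (2 * n - k) * s) /
          ((2 * (n : ℂ) - k - 2) * (2 * (n : ℂ) - k) * (2 * (n : ℂ) - k + 2)))) _ from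
    ⟨h.summable.norm, h.tsum_eq⟩
  obtain ⟨j, hj⟩ := hk
  obtain ⟨p, rfl | rfl⟩ : ∃ p : ℕ, k = 2 * p + 1 ∨ k = -(2 * p + 1) := by
    obtain hj0 | hj0 := le_or_gt 0 j
    · exact ⟨j.toNat, Or.inl (by omega)⟩
    · exact ⟨(-j - 1).toNat, Or.inr (by omega)⟩
  · have hsign : (2 * (p : ℤ) + 1).sign = 1 := Int.sign_eq_one_of_pos (by omega)
    have hrange : ((2 * (p : ℤ) + 1).natAbs - 1) / 2 + 1 = p + 1 := by omega
    rw [if_neg (by omega), hrange, hsign]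
    convert! (hasSum_exp_of_neg_start p hG).mul_left K using 1
    · push_cast; rfl
    · push_cast
      simp only [mul_one]
      ring
  · have hsign : (-(2 * (p : ℤ) + 1)).sign = -1 := Int.sign_eq_neg_one_of_neg (by omega)
    have hrange : ((-(2 * (p : ℤ) + 1)).natAbs - 1) / 2 + 1 = p + 1 := by omega
    rw [if_pos (by omega), hrange, hsign]
    have hlast : K * (Complex.exp (Complex.I * (2 * p + 1) * s) /
        ((2 * (p : ℂ) - 1) * (2 * (p : ℂ) + 1) * (2 * (p : ℂ) + 3))) = 1 := by
      have h1 := two_mul_intCast_add_one_ne_zero (p - 1)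
      have h2 := two_mul_intCast_add_one_ne_zero p
      have h3 := two_mul_intCast_add_one_ne_zero (p + 1)
      have hd : (2 * (p : ℂ) - 1) * (2 * (p : ℂ) + 1) * (2 * (p : ℂ) + 3) ≠ 0 := by
        convert! mul_ne_zero (mul_ne_zero h1 h2) h3 using 1
        push_cast; ring
      have he : Complex.exp (Complex.I * ((-(2 * (p : ℤ) + 1) : ℤ) : ℂ) * s) *
          Complex.exp (Complex.I * (2 * p + 1) * s) = 1 := by
        rw [← Complex.exp_add]
        convert! Complex.exp_zero using 2
        push_cast
        ring
      rw [← mul_div_assoc, div_eq_one_iff_eq hd, hK, mul_assoc _ (Complex.exp _), he]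
      push_cast
      ring
    convert! (hasSum_exp_of_pos_start p hG).mul_left K using 1
    · funext n
      push_cast
      simp only [sub_neg_eq_add]
    · rw [Finset.sum_range_succ]
      push_cast
      simp only [mul_neg, mul_one, neg_neg]
      linear_combination -hlast
end

section
/- Let k be an odd integer and x ∈ ℝ. Then the principal value (1/π)·PV∫ u_k'(y)/(x−y) dy exists and equals −2i·sgn(k)/(π(|k|+2)) − (2ik/π)·(x+i)^k·(x·(x²+1)^{1/2} + arsinh(x))/(x²+1)^{k/2+1} − ∑_{n=0}^{(|k|−1)/2} 8ik·(x+i)^{k−sgn(k)(2n+1)} / ( π·(2n−1)(2n+1)(2n+3)·(x²+1)^{(k−sgn(k)(2n+1))/2} ), where sgn(k) = k/|k| and u_k' = deriv u_k. -/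
open Filter MeasureTheory

/-- `u_k(y) = (y+i)^k/(y²+1)^{k/2}`, with `(y+i)^k` a `zpow` in `ℂ` and `(y²+1)^{k/2}` a real
power. -/
noncomputable def uFun (k : ℤ) (y : ℝ) : ℂ :=
  ((y : ℂ) + Complex.I) ^ k / ((((y ^ 2 + 1 : ℝ) ^ ((k : ℝ) / 2) : ℝ)) : ℂ)

/-- The unit complex number `(y+i)/√(y²+1)`, whose powers are the functions `uFun k`. -/
noncomputable def unitPhase (y : ℝ) : ℂ := ((y : ℂ) + Complex.I) / (Real.sqrt (y ^ 2 + 1) : ℂ)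

/-- The principal value `PV∫ f(y)/(x−y) dy` exists and equals `L`. -/
def HasPV (f : ℝ → ℂ) (x : ℝ) (L : ℂ) : Prop :=
  Tendsto (fun ε : ℝ => ∫ y in {y : ℝ | ε ≤ |x - y|}, f y / ((x : ℂ) - (y : ℂ)))
    (nhdsWithin 0 (Set.Ioi 0)) (nhds L)

lemma sqrt_sq_add_one_pos (y : ℝ) : 0 < Real.sqrt (y ^ 2 + 1) := by positivity

lemma sq_sqrt_sq_add_one (y : ℝ) : Real.sqrt (y ^ 2 + 1) ^ 2 = y ^ 2 + 1 :=
  Real.sq_sqrt (by positivity)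

lemma rpow_half_intCast {a : ℝ} (ha : 0 ≤ a) (k : ℤ) :
    a ^ ((k : ℝ) / 2) = Real.sqrt a ^ k := by
  rw [Real.sqrt_eq_rpow, ← Real.rpow_intCast, ← Real.rpow_mul ha]
  congr 1
  ring

lemma uFun_eq_unitPhase_zpow (k : ℤ) (y : ℝ) : uFun k y = unitPhase y ^ k := by
  rw [uFun, unitPhase, rpow_half_intCast (by positivity), div_zpow]
  push_cast
  rfl

lemma ofReal_add_I_ne_zero (y : ℝ) : (y : ℂ) + Complex.I ≠ 0 := fun h => by
  simpa using congrArg Complex.im h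

lemma ofReal_sub_I_ne_zero (y : ℝ) : (y : ℂ) - Complex.I ≠ 0 := fun h => by
  simpa using congrArg Complex.im h

lemma unitPhase_ne_zero (y : ℝ) : unitPhase y ≠ 0 :=
  div_ne_zero (ofReal_add_I_ne_zero y)
    (Complex.ofReal_ne_zero.mpr (sqrt_sq_add_one_pos y).ne')

lemma ofReal_sqrt_sq (y : ℝ) : ((Real.sqrt (y ^ 2 + 1) : ℝ) : ℂ) ^ 2 = (y : ℂ) ^ 2 + 1 := by
  exact_mod_cast sq_sqrt_sq_add_one y

lemma unitPhase_sq (y : ℝ) :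
    unitPhase y ^ 2 = ((y : ℂ) + Complex.I) / ((y : ℂ) - Complex.I) := by
  have h : (y : ℂ) ^ 2 + 1 = ((y : ℂ) + Complex.I) * ((y : ℂ) - Complex.I) := by
    linear_combination Complex.I_sq
  rw [unitPhase, div_pow, ofReal_sqrt_sq, h]
  have := ofReal_add_I_ne_zero y
  have := ofReal_sub_I_ne_zero y
  field_simp

lemma conj_unitPhase (y : ℝ) : (starRingEnd ℂ) (unitPhase y) = (unitPhase y)⁻¹ := by
  have h : (starRingEnd ℂ) (unitPhase y) * unitPhase y = 1 := by
    have hs : ((Real.sqrt (y ^ 2 + 1) : ℝ) : ℂ) ≠ 0 :=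
      Complex.ofReal_ne_zero.mpr (sqrt_sq_add_one_pos y).ne'
    simp only [unitPhase, map_div₀, map_add, Complex.conj_ofReal, Complex.conj_I]
    field_simp
    rw [ofReal_sqrt_sq]
    linear_combination -Complex.I_sq
  exact eq_inv_of_mul_eq_one_left h

lemma norm_unitPhase (y : ℝ) : ‖unitPhase y‖ = 1 := by
  have h : ((‖unitPhase y‖ ^ 2 : ℝ) : ℂ) = 1 := by
    rw [Complex.ofReal_pow, ← Complex.mul_conj', conj_unitPhase,
      mul_inv_cancel₀ (unitPhase_ne_zero y)]
  have h' : ‖unitPhase y‖ ^ 2 = 1 := by exact_mod_cast h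
  nlinarith [norm_nonneg (unitPhase y)]

lemma hasDerivAt_sqrt_sq_add_one (y : ℝ) :
    HasDerivAt (fun y : ℝ => Real.sqrt (y ^ 2 + 1)) (y / Real.sqrt (y ^ 2 + 1)) y := by
  have h : HasDerivAt (fun y : ℝ => y ^ 2 + 1) (2 * y) y := by
    simpa using (hasDerivAt_pow 2 y).add_const 1
  refine (h.sqrt (by positivity)).congr_deriv ?_
  field_simp

lemma hasDerivAt_unitPhase (y : ℝ) :
    HasDerivAt unitPhase (-Complex.I * unitPhase y / ((y : ℂ) ^ 2 + 1)) y := by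
  have hs : ((Real.sqrt (y ^ 2 + 1) : ℝ) : ℂ) ≠ 0 :=
    Complex.ofReal_ne_zero.mpr (sqrt_sq_add_one_pos y).ne'
  have h := (((hasDerivAt_id y).ofReal_comp).add_const Complex.I).div
    (hasDerivAt_sqrt_sq_add_one y).ofReal_comp hs
  refine h.congr_deriv ?_
  rw [unitPhase, ← ofReal_sqrt_sq]
  simp only [id, Complex.ofReal_one, Complex.ofReal_div]
  field_simp
  rw [ofReal_sqrt_sq]
  linear_combination Complex.I_sq

lemma hasDerivAt_unitPhase_zpow (k : ℤ) (y : ℝ) :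
    HasDerivAt (fun y => unitPhase y ^ k)
      (-(k * Complex.I) * (unitPhase y ^ k / ((y : ℂ) ^ 2 + 1))) y := by
  have h := (hasDerivAt_zpow k (unitPhase y) (Or.inl (unitPhase_ne_zero y))).comp y
    (hasDerivAt_unitPhase y)
  refine h.congr_deriv ?_
  rw [zpow_sub_one₀ (unitPhase_ne_zero y)]
  have := unitPhase_ne_zero y
  field_simp

lemma integrable_unitPhase_zpow_div (k : ℤ) :
    Integrable fun y : ℝ => unitPhase y ^ k / ((y : ℂ) ^ 2 + 1) := by
  have hne : ∀ y : ℝ, (y : ℂ) ^ 2 + 1 ≠ 0 := fun y => by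
    rw [← ofReal_sqrt_sq]
    exact pow_ne_zero _ (Complex.ofReal_ne_zero.mpr (sqrt_sq_add_one_pos y).ne')
  have hc : Continuous fun y => unitPhase y ^ k :=
    continuous_iff_continuousAt.mpr fun y => (hasDerivAt_unitPhase_zpow k y).continuousAt
  refine integrable_inv_one_add_sq.mono'
    (hc.div (by fun_prop) hne).aestronglyMeasurable (ae_of_all _ fun y => le_of_eq ?_)
  rw [norm_div, norm_zpow, norm_unitPhase, one_zpow, one_div, add_comm (1 : ℝ)]
  congr 1
  rw [← Complex.ofReal_pow, ← Complex.ofReal_one, ← Complex.ofReal_add, Complex.norm_real,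
    Real.norm_of_nonneg (by positivity)]

lemma tendsto_sqrt_sq_add_one_div_atTop :
    Tendsto (fun y : ℝ => Real.sqrt (y ^ 2 + 1) / y) atTop (nhds 1) := by
  have h : Tendsto (fun y : ℝ => Real.sqrt (1 + y⁻¹ ^ 2)) atTop (nhds 1) := by
    simpa using ((tendsto_inv_atTop_zero (𝕜 := ℝ).pow 2).const_add 1).sqrt
  refine h.congr' ?_
  filter_upwards [eventually_gt_atTop 0] with y hy
  rw [eq_div_iff hy.ne', ← Real.sqrt_sq hy.le, ← Real.sqrt_mul (by positivity),
    Real.sqrt_sq hy.le]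
  congr 1
  field_simp

lemma tendsto_sqrt_sq_add_one_div_atBot :
    Tendsto (fun y : ℝ => Real.sqrt (y ^ 2 + 1) / y) atBot (nhds (-1)) := by
  refine (tendsto_sqrt_sq_add_one_div_atTop.comp tendsto_neg_atBot_atTop).neg.congr fun y => ?_
  simp [div_neg]

lemma tendsto_unitPhase {l : Filter ℝ} {c : ℝ} (hc : c ≠ 0)
    (h0 : ∀ᶠ y in l, y ≠ 0) (hinv : Tendsto (fun y : ℝ => y⁻¹) l (nhds 0))
    (hs : Tendsto (fun y : ℝ => Real.sqrt (y ^ 2 + 1) / y) l (nhds c)) :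
    Tendsto unitPhase l (nhds ((c⁻¹ : ℝ) : ℂ)) := by
  have h : Tendsto (fun y : ℝ => (1 + ((y⁻¹ : ℝ) : ℂ) * Complex.I) /
      ((Real.sqrt (y ^ 2 + 1) / y : ℝ) : ℂ)) l (nhds ((1 + ((0 : ℝ) : ℂ) * Complex.I) / (c : ℂ))) :=
    ((((Complex.continuous_ofReal.tendsto _).comp hinv).mul_const _).const_add _).div
      ((Complex.continuous_ofReal.tendsto _).comp hs) (Complex.ofReal_ne_zero.mpr hc)
  have e : (1 + ((0 : ℝ) : ℂ) * Complex.I) / (c : ℂ) = ((c⁻¹ : ℝ) : ℂ) := by simp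
  rw [e] at h
  refine h.congr' ?_
  filter_upwards [h0] with y hy
  have : (y : ℂ) ≠ 0 := Complex.ofReal_ne_zero.mpr hy
  have hs : ((Real.sqrt (y ^ 2 + 1) : ℝ) : ℂ) ≠ 0 :=
    Complex.ofReal_ne_zero.mpr (sqrt_sq_add_one_pos y).ne'
  rw [unitPhase]
  push_cast
  field_simp

lemma tendsto_unitPhase_atTop : Tendsto unitPhase atTop (nhds 1) := by
  simpa using tendsto_unitPhase one_ne_zero (eventually_ne_atTop 0) tendsto_inv_atTop_zero
    tendsto_sqrt_sq_add_one_div_atTop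

lemma tendsto_unitPhase_atBot : Tendsto unitPhase atBot (nhds (-1)) := by
  simpa using tendsto_unitPhase (neg_ne_zero.mpr one_ne_zero) (eventually_ne_atBot 0)
    tendsto_inv_atBot_zero tendsto_sqrt_sq_add_one_div_atBot

lemma integral_unitPhase_zpow_div {k : ℤ} (hk : Odd k) :
    ∫ y : ℝ, unitPhase y ^ k / ((y : ℂ) ^ 2 + 1) = 2 * Complex.I / k := by
  have hk0 : (k : ℂ) ≠ 0 := by
    rintro h
    norm_cast at h
    subst h
    simp at hk
  have h := integral_of_hasDerivAt_of_tendsto (hasDerivAt_unitPhase_zpow k)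
    ((integrable_unitPhase_zpow_div k).const_mul _)
    (tendsto_unitPhase_atBot.zpow₀ k (Or.inl (by simp)))
    (tendsto_unitPhase_atTop.zpow₀ k (Or.inl one_ne_zero))
  rw [integral_const_mul, one_zpow, hk.neg_one_zpow] at h
  rw [eq_div_iff hk0]
  linear_combination Complex.I * h + (k : ℂ) * (∫ y : ℝ, unitPhase y ^ k / ((y : ℂ) ^ 2 + 1)) *
    Complex.I_sq

lemma measurableSet_le_abs_sub (x ε : ℝ) : MeasurableSet {y : ℝ | ε ≤ |x - y|} :=
  measurableSet_le measurable_const (by fun_prop)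

lemma integrableOn_div_sub {f : ℝ → ℂ} (hf : Integrable f) (x : ℝ) {ε : ℝ} (hε : 0 < ε) :
    IntegrableOn (fun y => f y / ((x : ℂ) - (y : ℂ))) {y : ℝ | ε ≤ |x - y|} := by
  simp only [div_eq_mul_inv]
  refine hf.integrableOn.mul_bdd (c := ε⁻¹) (Measurable.aestronglyMeasurable (by fun_prop)) ?_
  filter_upwards [ae_restrict_mem (measurableSet_le_abs_sub x ε)] with y hy
  rw [norm_inv, ← Complex.ofReal_sub, Complex.norm_real]
  exact inv_anti₀ hε hy

lemma tendsto_setIntegral_le_abs_sub {f : ℝ → ℂ} (hf : Integrable f) (x : ℝ) :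
    Tendsto (fun ε : ℝ => ∫ y in {y : ℝ | ε ≤ |x - y|}, f y) (nhdsWithin 0 (Set.Ioi 0))
      (nhds (∫ y, f y)) := by
  simp_rw [← integral_indicator (measurableSet_le_abs_sub x _)]
  refine tendsto_integral_filter_of_dominated_convergence (fun y => ‖f y‖)
    (Eventually.of_forall fun ε =>
      hf.aestronglyMeasurable.indicator (measurableSet_le_abs_sub x ε))
    (Eventually.of_forall fun ε => ae_of_all _ fun y => norm_indicator_le_norm_self _ _)
    hf.norm ?_
  have hx : ∀ᵐ y : ℝ, y ≠ x := by simp [ae_iff]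
  filter_upwards [hx] with y hy
  refine tendsto_const_nhds.congr' ?_
  have hpos : 0 < |x - y| := abs_pos.mpr (sub_ne_zero.mpr hy.symm)
  filter_upwards [mem_nhdsWithin_of_mem_nhds (Iio_mem_nhds hpos)] with ε hε
  rw [Set.indicator_of_mem]
  exact (Set.mem_Iio.mp hε).le

lemma HasPV.of_hasDerivAt {f G : ℝ → ℂ} {x : ℝ} {a b : ℂ} (hf : Integrable f)
    (hG : ∀ y, y ≠ x → HasDerivAt G (f y / ((x : ℂ) - (y : ℂ))) y)
    (hbot : Tendsto G atBot (nhds a)) (htop : Tendsto G atTop (nhds b))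
    (hx : Tendsto (fun ε : ℝ => G (x - ε) - G (x + ε)) (nhdsWithin 0 (Set.Ioi 0)) (nhds 0)) :
    HasPV f x (b - a) := by
  have h := hx.add_const (b - a)
  rw [zero_add] at h
  refine h.congr' ?_
  filter_upwards [self_mem_nhdsWithin] with ε hε
  rw [Set.mem_Ioi] at hε
  have hset : {y : ℝ | ε ≤ |x - y|} = Set.Iic (x - ε) ∪ Set.Ici (x + ε) := by
    ext y
    simp only [Set.mem_ofPred_eq, Set.mem_union, Set.mem_Iic, Set.mem_Ici, le_abs]
    constructor <;> rintro (h | h)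
    · left; linarith
    · right; linarith
    · left; linarith
    · right; linarith
  have hint := integrableOn_div_sub hf x hε
  rw [hset] at hint ⊢
  have hleft := hint.left_of_union
  have hright := hint.right_of_union
  rw [setIntegral_union (Set.disjoint_left.mpr fun y h1 h2 => by
      simp only [Set.mem_Iic, Set.mem_Ici] at h1 h2; linarith) measurableSet_Ici hleft hright,
    integral_Ici_eq_integral_Ioi,
    integral_Iic_of_hasDerivAt_of_tendsto' (fun y hy => hG y fun h => by
      simp only [Set.mem_Iic] at hy; linarith) hleft hbot,
    integral_Ioi_of_hasDerivAt_of_tendsto' (fun y hy => hG y fun h => by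
      simp only [Set.mem_Ici] at hy; linarith) (hright.mono_set Set.Ioi_subset_Ici_self) htop]
  ring

lemma one_add_mul_add_sqrt_mul_sqrt_pos (x y : ℝ) :
    0 < 1 + x * y + Real.sqrt (x ^ 2 + 1) * Real.sqrt (y ^ 2 + 1) := by
  have h : |x * y| ≤ Real.sqrt (x ^ 2 + 1) * Real.sqrt (y ^ 2 + 1) := by
    rw [← Real.sqrt_mul (by positivity)]
    exact Real.abs_le_sqrt (by nlinarith [sq_nonneg x, sq_nonneg y])
  linarith [neg_abs_le (x * y)]

/-- An antiderivative of `1/((y²+1)^{3/2}(x−y))`, up to the factor `x²+1`. -/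
noncomputable def realPrimitive (x y : ℝ) : ℝ :=
  (Real.log (1 + x * y + Real.sqrt (x ^ 2 + 1) * Real.sqrt (y ^ 2 + 1)) - Real.log (x - y))
    / Real.sqrt (x ^ 2 + 1) + (x * y - 1) / Real.sqrt (y ^ 2 + 1)

lemma hasDerivAt_realPrimitive {x y : ℝ} (hy : y ≠ x) :
    HasDerivAt (realPrimitive x) ((x ^ 2 + 1) / (Real.sqrt (y ^ 2 + 1) ^ 3 * (x - y))) y := by
  have hs := hasDerivAt_sqrt_sq_add_one y
  have hxy : x - y ≠ 0 := sub_ne_zero.mpr hy.symm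
  have hlin := (hasDerivAt_id y).const_mul x
  have hpos := one_add_mul_add_sqrt_mul_sqrt_pos x y
  have h := (((((hlin.const_add 1).add (hs.const_mul (Real.sqrt (x ^ 2 + 1)))).log hpos.ne').sub
    (((hasDerivAt_id y).const_sub x).log hxy)).div_const (Real.sqrt (x ^ 2 + 1))).add
    ((hlin.sub_const 1).div hs (sqrt_sq_add_one_pos y).ne')
  refine h.congr_deriv ?_
  have e1 := sq_sqrt_sq_add_one x
  have e2 := sq_sqrt_sq_add_one y
  have p1 := (sqrt_sq_add_one_pos x).ne'
  have p2 := (sqrt_sq_add_one_pos y).ne'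
  simp only [id, mul_one, Pi.add_apply]
  generalize Real.sqrt (x ^ 2 + 1) = q at *
  generalize Real.sqrt (y ^ 2 + 1) = s at *
  have hlog : ((x + q * (y / s)) / (1 + x * y + q * s) - -1 / (x - y)) / q = 1 / (s * (x - y)) := by
    have hpos' := hpos.ne'
    field_simp
    linear_combination -s * e1 + q * e2
  rw [hlog]
  field_simp
  linear_combination (x - y) * x * e2 + e2

lemma tendsto_realPrimitive {x : ℝ} {l : Filter ℝ} {c : ℝ} (hc : c ≠ 0)
    (h0 : ∀ᶠ y in l, y ≠ 0) (hx : ∀ᶠ y in l, y ≠ x)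
    (hinv : Tendsto (fun y : ℝ => y⁻¹) l (nhds 0))
    (hs : Tendsto (fun y : ℝ => Real.sqrt (y ^ 2 + 1) / y) l (nhds c))
    (hq : x + Real.sqrt (x ^ 2 + 1) * c ≠ 0) :
    Tendsto (realPrimitive x) l
      (nhds (Real.log (x + Real.sqrt (x ^ 2 + 1) * c) / Real.sqrt (x ^ 2 + 1) + x / c)) := by
  have h1 : Tendsto (fun y : ℝ => Real.log
      ((y⁻¹ + x + Real.sqrt (x ^ 2 + 1) * (Real.sqrt (y ^ 2 + 1) / y)) / (x * y⁻¹ - 1)))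
      l (nhds (Real.log ((0 + x + Real.sqrt (x ^ 2 + 1) * c) / (x * 0 - 1)))) :=
    (((hinv.add_const x).add (hs.const_mul _)).div ((hinv.const_mul x).sub_const 1)
      (by simp)).log (by simpa using hq)
  have h2 : Tendsto (fun y : ℝ => (x - y⁻¹) / (Real.sqrt (y ^ 2 + 1) / y)) l
      (nhds ((x - 0) / c)) := (hinv.const_sub x).div hs hc
  have h := (h1.div_const (Real.sqrt (x ^ 2 + 1))).add h2
  have e : (0 + x + Real.sqrt (x ^ 2 + 1) * c) / (x * 0 - 1) = -(x + Real.sqrt (x ^ 2 + 1) * c) := by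
    ring
  rw [e, Real.log_neg_eq_log, sub_zero] at h
  refine h.congr' ?_
  filter_upwards [h0, hx] with y hy hyx
  have hxy : x - y ≠ 0 := sub_ne_zero.mpr hyx.symm
  have p2 := (sqrt_sq_add_one_pos y).ne'
  rw [realPrimitive, ← Real.log_div (one_add_mul_add_sqrt_mul_sqrt_pos x y).ne' hxy]
  have hlog : (y⁻¹ + x + Real.sqrt (x ^ 2 + 1) * (Real.sqrt (y ^ 2 + 1) / y)) / (x * y⁻¹ - 1)
      = (1 + x * y + Real.sqrt (x ^ 2 + 1) * Real.sqrt (y ^ 2 + 1)) / (x - y) := by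
    rw [← mul_div_mul_right _ (x * y⁻¹ - 1) hy]
    congr 1 <;> field_simp
  rw [hlog]
  congr 1
  field_simp

lemma tendsto_realPrimitive_atTop (x : ℝ) :
    Tendsto (realPrimitive x) atTop (nhds (Real.arsinh x / Real.sqrt (x ^ 2 + 1) + x)) := by
  have hq : x + Real.sqrt (x ^ 2 + 1) = Real.exp (Real.arsinh x) := by
    rw [Real.exp_arsinh, add_comm (x ^ 2)]
  have h := tendsto_realPrimitive (x := x) one_ne_zero (eventually_ne_atTop 0)
    (eventually_ne_atTop x) tendsto_inv_atTop_zero tendsto_sqrt_sq_add_one_div_atTop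
    (by rw [mul_one, hq]; exact (Real.exp_pos _).ne')
  rwa [mul_one, hq, Real.log_exp, div_one] at h

lemma tendsto_realPrimitive_atBot (x : ℝ) :
    Tendsto (realPrimitive x) atBot (nhds (-(Real.arsinh x / Real.sqrt (x ^ 2 + 1) + x))) := by
  have hq : x + Real.sqrt (x ^ 2 + 1) * (-1) = -Real.exp (-Real.arsinh x) := by
    rw [← Real.arsinh_neg, Real.exp_arsinh, neg_sq, add_comm (x ^ 2)]
    ring
  have h := tendsto_realPrimitive (x := x) (neg_ne_zero.mpr one_ne_zero) (eventually_ne_atBot 0)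
    (eventually_ne_atBot x) tendsto_inv_atBot_zero tendsto_sqrt_sq_add_one_div_atBot
    (by rw [hq]; exact neg_ne_zero.mpr (Real.exp_pos _).ne')
  rw [hq, Real.log_neg_eq_log, Real.log_exp] at h
  convert h using 2
  ring

lemma tendsto_realPrimitive_sub (x : ℝ) :
    Tendsto (fun ε : ℝ => realPrimitive x (x - ε) - realPrimitive x (x + ε))
      (nhdsWithin 0 (Set.Ioi 0)) (nhds 0) := by
  let H : ℝ → ℝ := fun y =>
    Real.log (1 + x * y + Real.sqrt (x ^ 2 + 1) * Real.sqrt (y ^ 2 + 1)) / Real.sqrt (x ^ 2 + 1)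
      + (x * y - 1) / Real.sqrt (y ^ 2 + 1)
  have hH : Continuous H :=
    ((Continuous.log (by fun_prop)
      fun y => (one_add_mul_add_sqrt_mul_sqrt_pos x y).ne').div_const _).add
      (Continuous.div (by fun_prop) (by fun_prop) fun y => (sqrt_sq_add_one_pos y).ne')
  have hc : Continuous fun ε : ℝ => H (x - ε) - H (x + ε) := by fun_prop
  have h : Tendsto (fun ε : ℝ => H (x - ε) - H (x + ε)) (nhds 0) (nhds 0) := by
    simpa using hc.tendsto 0
  refine (h.mono_left nhdsWithin_le_nhds).congr fun ε => ?_
  simp only [H, realPrimitive, sub_sub_cancel, sub_add_cancel_left, Real.log_neg_eq_log]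
  ring

lemma hasPV_unitPhase (x : ℝ) :
    HasPV (fun y => unitPhase y ^ (1 : ℤ) / ((y : ℂ) ^ 2 + 1)) x
      (2 * (((x : ℂ) + Complex.I) / ((x : ℂ) ^ 2 + 1)
        * ((Real.arsinh x / Real.sqrt (x ^ 2 + 1) + x : ℝ) : ℂ) - 1)) := by
  set P : ℂ := ((x : ℂ) + Complex.I) / ((x : ℂ) ^ 2 + 1) with hP
  have key : ∀ c d : ℝ, ∀ l : Filter ℝ, Tendsto (realPrimitive x) l (nhds c) →
      Tendsto (fun y : ℝ => y / Real.sqrt (y ^ 2 + 1)) l (nhds d) →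
      Tendsto (fun y => P * (realPrimitive x y : ℂ) - ((y / Real.sqrt (y ^ 2 + 1) : ℝ) : ℂ)) l
        (nhds (P * (c : ℂ) - (d : ℂ))) := fun c d l h1 h2 =>
    (((Complex.continuous_ofReal.tendsto _).comp h1).const_mul P).sub
      ((Complex.continuous_ofReal.tendsto _).comp h2)
  have hd : ∀ y : ℝ, HasDerivAt (fun y : ℝ => y / Real.sqrt (y ^ 2 + 1))
      (1 / Real.sqrt (y ^ 2 + 1) ^ 3) y := fun y => by
    have p2 := (sqrt_sq_add_one_pos y).ne'
    refine ((hasDerivAt_id y).div (hasDerivAt_sqrt_sq_add_one y) p2).congr_deriv ?_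
    simp only [id]
    field_simp
    linear_combination sq_sqrt_sq_add_one y
  have hdc : Continuous fun y : ℝ => y / Real.sqrt (y ^ 2 + 1) :=
    continuous_iff_continuousAt.mpr fun y => (hd y).continuousAt
  have htop : Tendsto (fun y : ℝ => y / Real.sqrt (y ^ 2 + 1)) atTop (nhds 1) := by
    simpa using tendsto_sqrt_sq_add_one_div_atTop.inv₀ one_ne_zero
  have hbot : Tendsto (fun y : ℝ => y / Real.sqrt (y ^ 2 + 1)) atBot (nhds (-1)) := by
    simpa using tendsto_sqrt_sq_add_one_div_atBot.inv₀ (neg_ne_zero.mpr one_ne_zero)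
  have h := HasPV.of_hasDerivAt (x := x) (integrable_unitPhase_zpow_div 1) (fun y hy => ?_)
    (key _ _ _ (tendsto_realPrimitive_atBot x) hbot)
    (key _ _ _ (tendsto_realPrimitive_atTop x) htop) ?_
  · convert h using 1
    push_cast
    ring
  · refine ((((hasDerivAt_realPrimitive hy).ofReal_comp).const_mul P).sub
      (hd y).ofReal_comp).congr_deriv ?_
    have hxy : (x : ℂ) - (y : ℂ) ≠ 0 := sub_ne_zero.mpr fun h => hy (by exact_mod_cast h.symm)
    have hs : ((Real.sqrt (y ^ 2 + 1) : ℝ) : ℂ) ≠ 0 :=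
      Complex.ofReal_ne_zero.mpr (sqrt_sq_add_one_pos y).ne'
    have hx : (x : ℂ) ^ 2 + 1 ≠ 0 := by
      rw [← ofReal_sqrt_sq]
      exact pow_ne_zero _ (Complex.ofReal_ne_zero.mpr (sqrt_sq_add_one_pos x).ne')
    rw [zpow_one, unitPhase, ← ofReal_sqrt_sq, hP]
    push_cast
    field_simp
    ring
  · have h1 := (Complex.continuous_ofReal.tendsto _).comp (tendsto_realPrimitive_sub x)
    have hc : Continuous fun ε : ℝ => (((x + ε) / Real.sqrt ((x + ε) ^ 2 + 1) : ℝ) : ℂ)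
        - (((x - ε) / Real.sqrt ((x - ε) ^ 2 + 1) : ℝ) : ℂ) :=
      (Complex.continuous_ofReal.comp (hdc.comp (continuous_const.add continuous_id))).sub
        (Complex.continuous_ofReal.comp (hdc.comp (continuous_const.sub continuous_id)))
    have h2 := (hc.tendsto 0).mono_left (nhdsWithin_le_nhds (s := Set.Ioi 0))
    have h3 := (h1.const_mul P).add h2
    simp only [add_zero, sub_zero, sub_self, Complex.ofReal_zero, mul_zero] at h3
    refine h3.congr fun ε => ?_
    simp only [Function.comp_apply, Complex.ofReal_sub]
    ring

lemma HasPV.unitPhase_zpow_add_two {k : ℤ} {x : ℝ} {L : ℂ}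
    (h : HasPV (fun y => unitPhase y ^ k / ((y : ℂ) ^ 2 + 1)) x L) :
    HasPV (fun y => unitPhase y ^ (k + 2) / ((y : ℂ) ^ 2 + 1)) x
      (unitPhase x ^ 2 * L + ((∫ y : ℝ, unitPhase y ^ (k + 2) / ((y : ℂ) ^ 2 + 1))
        - ∫ y : ℝ, unitPhase y ^ k / ((y : ℂ) ^ 2 + 1)) / ((x : ℂ) - Complex.I)) := by
  have i1 := integrable_unitPhase_zpow_div (k + 2)
  have i0 := integrable_unitPhase_zpow_div k
  have hlim := (Tendsto.const_mul (unitPhase x ^ 2) h).add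
    (((tendsto_setIntegral_le_abs_sub i1 x).sub
      (tendsto_setIntegral_le_abs_sub i0 x)).div_const ((x : ℂ) - Complex.I))
  refine hlim.congr' ?_
  filter_upwards [self_mem_nhdsWithin] with ε hε
  have i2 := (integrableOn_div_sub i0 x hε).integrable.const_mul (unitPhase x ^ 2)
  have i3 : Integrable (fun y : ℝ => (unitPhase y ^ (k + 2) / ((y : ℂ) ^ 2 + 1)
      - unitPhase y ^ k / ((y : ℂ) ^ 2 + 1)) / ((x : ℂ) - Complex.I))
      (volume.restrict {y : ℝ | ε ≤ |x - y|}) :=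
    ((i1.sub i0).div_const _).restrict
  rw [← integral_sub i1.integrableOn i0.integrableOn, ← integral_div, ← integral_const_mul,
    ← integral_add i2 i3]
  refine setIntegral_congr_fun (measurableSet_le_abs_sub x ε) fun y hy => ?_
  have hxy : (x : ℂ) - (y : ℂ) ≠ 0 := by
    rw [← Complex.ofReal_sub, Complex.ofReal_ne_zero]
    exact abs_pos.mp (lt_of_lt_of_le hε hy)
  have hyy : (y : ℂ) ^ 2 + 1 ≠ 0 := by
    rw [← ofReal_sqrt_sq]
    exact pow_ne_zero _ (Complex.ofReal_ne_zero.mpr (sqrt_sq_add_one_pos y).ne')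
  have hx := ofReal_sub_I_ne_zero x
  have hy' := ofReal_sub_I_ne_zero y
  rw [zpow_add₀ (unitPhase_ne_zero y), zpow_two, ← pow_two, unitPhase_sq, unitPhase_sq]
  field_simp
  ring

/-- The sum `2/(k(k+2)) + 2Wᵏ(x√(x²+1) + arsinh x)/(x²+1) + ∑ 8W^{k−2n−1}/((2n−1)(2n+1)(2n+3))`
for `k = 2m+1` and `W = unitPhase x`. -/
noncomputable def pvValue (m : ℕ) (x : ℝ) : ℂ :=
  2 / ((2 * (m : ℂ) + 1) * (2 * (m : ℂ) + 3))
    + 2 * unitPhase x ^ (2 * (m : ℤ) + 1)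
      * ((x * Real.sqrt (x ^ 2 + 1) + Real.arsinh x : ℝ) : ℂ) / ((x : ℂ) ^ 2 + 1)
    + ∑ n ∈ Finset.range (m + 1), 8 * unitPhase x ^ (2 * (m : ℤ) - 2 * (n : ℤ))
      / ((2 * (n : ℂ) - 1) * (2 * (n : ℂ) + 1) * (2 * (n : ℂ) + 3))

lemma pvValue_succ (m : ℕ) (x : ℝ) :
    pvValue (m + 1) x = unitPhase x ^ 2 * pvValue m x
      + 2 * (1 - unitPhase x ^ 2) / ((2 * (m : ℂ) + 1) * (2 * (m : ℂ) + 3)) := by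
  have hW := unitPhase_ne_zero x
  have h1 : (2 * (m : ℂ) + 1) ≠ 0 := by exact_mod_cast Nat.succ_ne_zero (2 * m)
  have h3 : (2 * (m : ℂ) + 3) ≠ 0 := by exact_mod_cast Nat.succ_ne_zero (2 * m + 2)
  have h5 : (2 * (m : ℂ) + 5) ≠ 0 := by exact_mod_cast Nat.succ_ne_zero (2 * m + 4)
  have hp : unitPhase x ^ (2 * ((m + 1 : ℕ) : ℤ) + 1)
      = unitPhase x ^ 2 * unitPhase x ^ (2 * (m : ℤ) + 1) := by
    rw [← zpow_natCast, ← zpow_add₀ hW]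
    congr 1
    push_cast
    ring
  have hsum : ∑ n ∈ Finset.range (m + 1), 8 * unitPhase x ^ (2 * ((m + 1 : ℕ) : ℤ) - 2 * (n : ℤ))
        / ((2 * (n : ℂ) - 1) * (2 * (n : ℂ) + 1) * (2 * (n : ℂ) + 3))
      = unitPhase x ^ 2 * ∑ n ∈ Finset.range (m + 1), 8 * unitPhase x ^ (2 * (m : ℤ) - 2 * (n : ℤ))
        / ((2 * (n : ℂ) - 1) * (2 * (n : ℂ) + 1) * (2 * (n : ℂ) + 3)) := by
    rw [Finset.mul_sum]
    refine Finset.sum_congr rfl fun n _ => ?_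
    have e : unitPhase x ^ (2 * ((m + 1 : ℕ) : ℤ) - 2 * (n : ℤ))
        = unitPhase x ^ 2 * unitPhase x ^ (2 * (m : ℤ) - 2 * (n : ℤ)) := by
      rw [← zpow_natCast, ← zpow_add₀ hW]
      congr 1
      push_cast
      ring
    rw [e]
    ring
  rw [pvValue, Finset.sum_range_succ, hsum, hp, sub_self, zpow_zero, pvValue]
  have e1 : 2 * ((m + 1 : ℕ) : ℂ) - 1 = 2 * (m : ℂ) + 1 := by push_cast; ring
  have e2 : 2 * ((m + 1 : ℕ) : ℂ) + 1 = 2 * (m : ℂ) + 3 := by push_cast; ring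
  have e3 : 2 * ((m + 1 : ℕ) : ℂ) + 3 = 2 * (m : ℂ) + 5 := by push_cast; ring
  rw [e1, e2, e3]
  have e : 2 / ((2 * (m : ℂ) + 3) * (2 * (m : ℂ) + 5))
      + 8 * 1 / ((2 * (m : ℂ) + 1) * (2 * (m : ℂ) + 3) * (2 * (m : ℂ) + 5))
      = 2 / ((2 * (m : ℂ) + 1) * (2 * (m : ℂ) + 3)) := by
    field_simp
    ring
  linear_combination e

lemma hasPV_unitPhase_zpow (m : ℕ) (x : ℝ) :
    HasPV (fun y => unitPhase y ^ (2 * (m : ℤ) + 1) / ((y : ℂ) ^ 2 + 1)) x (pvValue m x) := by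
  induction m with
  | zero =>
    have h := hasPV_unitPhase x
    have hs : ((Real.sqrt (x ^ 2 + 1) : ℝ) : ℂ) ≠ 0 :=
      Complex.ofReal_ne_zero.mpr (sqrt_sq_add_one_pos x).ne'
    have e : 2 * (((x : ℂ) + Complex.I) / ((x : ℂ) ^ 2 + 1)
        * ((Real.arsinh x / Real.sqrt (x ^ 2 + 1) + x : ℝ) : ℂ) - 1) = pvValue 0 x := by
      simp only [pvValue, unitPhase, ← ofReal_sqrt_sq, Finset.sum_range_succ, Finset.sum_range_zero]
      push_cast
      rw [mul_zero, zero_add, zpow_one, zpow_zero]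
      field_simp
      ring
    rw [e] at h
    simpa using h
  | succ m ih =>
    have h := ih.unitPhase_zpow_add_two
    rw [integral_unitPhase_zpow_div ⟨(m : ℤ) + 1, by ring⟩,
      integral_unitPhase_zpow_div ⟨(m : ℤ), rfl⟩] at h
    convert h using 1
    · funext y
      congr 2
    · have h1 : (2 * (m : ℂ) + 1) ≠ 0 := by exact_mod_cast Nat.succ_ne_zero (2 * m)
      have h3 : (2 * (m : ℂ) + 1 + 2) ≠ 0 := by exact_mod_cast Nat.succ_ne_zero (2 * m + 2)
      have hx := ofReal_sub_I_ne_zero x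
      have e3 : 2 * (m : ℂ) + 3 = 2 * (m : ℂ) + 1 + 2 := by ring
      rw [pvValue_succ, unitPhase_sq, e3]
      push_cast
      field_simp
      ring

lemma HasPV.conj {f : ℝ → ℂ} {x : ℝ} {L : ℂ} (h : HasPV f x L) :
    HasPV (fun y => (starRingEnd ℂ) (f y)) x ((starRingEnd ℂ) L) := by
  refine ((Complex.continuous_conj.tendsto L).comp h).congr fun ε => ?_
  rw [Function.comp_apply, ← integral_conj]
  simp

lemma HasPV.deriv_uFun {k : ℤ} {x : ℝ} {L : ℂ}
    (h : HasPV (fun y => unitPhase y ^ k / ((y : ℂ) ^ 2 + 1)) x L) :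
    Tendsto (fun ε : ℝ => (1 / (Real.pi : ℂ)) *
        ∫ y in {y : ℝ | ε ≤ |x - y|}, deriv (uFun k) y / ((x : ℂ) - (y : ℂ)))
      (nhdsWithin 0 (Set.Ioi 0)) (nhds (-(k * Complex.I) / Real.pi * L)) := by
  refine (Tendsto.const_mul (-(k * Complex.I) / (Real.pi : ℂ)) h).congr fun ε => ?_
  have hd : deriv (uFun k) = fun y : ℝ =>
      -(k * Complex.I) * (unitPhase y ^ k / ((y : ℂ) ^ 2 + 1)) := by
    rw [funext (uFun_eq_unitPhase_zpow k)]
    exact funext fun y => (hasDerivAt_unitPhase_zpow k y).deriv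
  simp_rw [hd, mul_div_assoc (-(k * Complex.I : ℂ)), integral_const_mul]
  ring

/-- For `k` odd and `x ∈ ℝ`, the principal value `(1/π)·PV∫ u_k'(y)/(x−y) dy` exists and equals
`−2i·sgn(k)/(π(|k|+2)) − (2ik/π)(x+i)^k(x√(x²+1) + arsinh x)/(x²+1)^{k/2+1}
 − ∑_{n=0}^{(|k|−1)/2} 8ik(x+i)^{k−sgn(k)(2n+1)}/(π(2n−1)(2n+1)(2n+3)(x²+1)^{(k−sgn(k)(2n+1))/2})`. -/
theorem halfLaplacian_uFun_odd (k : ℤ) (hk : Odd k) (x : ℝ) :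
    Tendsto (fun ε : ℝ => (1 / (Real.pi : ℂ)) *
        ∫ y in {y : ℝ | ε ≤ |x - y|}, deriv (uFun k) y / ((x : ℂ) - (y : ℂ)))
      (nhdsWithin 0 (Set.Ioi 0))
      (nhds (
        -2 * Complex.I * (k.sign : ℂ) / ((Real.pi : ℂ) * ((k.natAbs : ℂ) + 2))
        - (2 * Complex.I * (k : ℂ) / (Real.pi : ℂ)) * ((x : ℂ) + Complex.I) ^ k
            * ((x * Real.sqrt (x ^ 2 + 1) + Real.arsinh x : ℝ) : ℂ)
            / ((((x ^ 2 + 1 : ℝ) ^ ((k : ℝ) / 2 + 1) : ℝ)) : ℂ)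
        - ∑ n ∈ Finset.range ((k.natAbs - 1) / 2 + 1),
            8 * Complex.I * (k : ℂ) * ((x : ℂ) + Complex.I) ^ (k - k.sign * (2 * (n : ℤ) + 1))
              / ((Real.pi : ℂ) * (2 * (n : ℂ) - 1) * (2 * (n : ℂ) + 1) * (2 * (n : ℂ) + 3)
                * ((((x ^ 2 + 1 : ℝ) ^ (((k - k.sign * (2 * (n : ℤ) + 1) : ℤ) : ℝ) / 2) : ℝ)) : ℂ)))) := by
  have hpow : ∀ e : ℤ, ((x : ℂ) + Complex.I) ^ e
      = unitPhase x ^ e * ((((x ^ 2 + 1 : ℝ) ^ ((e : ℝ) / 2) : ℝ)) : ℂ) := fun e => by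
    have hne : ((((x ^ 2 + 1 : ℝ) ^ ((e : ℝ) / 2) : ℝ)) : ℂ) ≠ 0 :=
      Complex.ofReal_ne_zero.mpr (Real.rpow_pos_of_pos (by positivity) _).ne'
    rw [← uFun_eq_unitPhase_zpow, uFun, div_mul_cancel₀ _ hne]
  have hne : ∀ e : ℤ, ((((x ^ 2 + 1 : ℝ) ^ ((e : ℝ) / 2) : ℝ)) : ℂ) ≠ 0 := fun e =>
    Complex.ofReal_ne_zero.mpr (Real.rpow_pos_of_pos (by positivity) _).ne'
  have hx : (x : ℂ) ^ 2 + 1 ≠ 0 := by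
    rw [← ofReal_sqrt_sq]
    exact pow_ne_zero _ (Complex.ofReal_ne_zero.mpr (sqrt_sq_add_one_pos x).ne')
  have hpi : (Real.pi : ℂ) ≠ 0 := Complex.ofReal_ne_zero.mpr Real.pi_ne_zero
  have hr : (x ^ 2 + 1 : ℝ) ^ ((k : ℝ) / 2 + 1) = (x ^ 2 + 1 : ℝ) ^ ((k : ℝ) / 2) * (x ^ 2 + 1) :=
    Real.rpow_add_one (by positivity) _
  have hterm : ∀ (e : ℤ) (c d : ℂ), c * (unitPhase x ^ e
      * ((((x ^ 2 + 1 : ℝ) ^ ((e : ℝ) / 2) : ℝ)) : ℂ))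
      / (d * ((((x ^ 2 + 1 : ℝ) ^ ((e : ℝ) / 2) : ℝ)) : ℂ)) = c * unitPhase x ^ e / d :=
    fun e c d => by rw [← mul_assoc, mul_div_mul_right _ _ (hne e)]
  have hmid : ∀ c d : ℂ, c * (unitPhase x ^ k
      * ((((x ^ 2 + 1 : ℝ) ^ ((k : ℝ) / 2) : ℝ)) : ℂ)) * d
      / (((((x ^ 2 + 1 : ℝ) ^ ((k : ℝ) / 2) : ℝ)) : ℂ) * ((x : ℂ) ^ 2 + 1))
      = c * unitPhase x ^ k * d / ((x : ℂ) ^ 2 + 1) := fun c d => by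
    have := hne k
    field_simp
  simp only [hpow, hterm, hr]
  rw [Complex.ofReal_mul, Complex.ofReal_add (x ^ 2), Complex.ofReal_pow, Complex.ofReal_one, hmid]
  obtain ⟨m, rfl | rfl⟩ : ∃ m : ℕ, k = 2 * (m : ℤ) + 1 ∨ k = -(2 * (m : ℤ) + 1) := by
    obtain ⟨j, rfl⟩ := hk
    rcases le_or_gt 0 j with hj | hj
    · exact ⟨j.toNat, Or.inl (by omega)⟩
    · exact ⟨(-j - 1).toNat, Or.inr (by omega)⟩
  all_goals
    have h1 : (2 * (m : ℂ) + 1) ≠ 0 := by exact_mod_cast Nat.succ_ne_zero (2 * m)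
    have h3 : (2 * (m : ℂ) + 3) ≠ 0 := by exact_mod_cast Nat.succ_ne_zero (2 * m + 2)
    have hm : ((2 * m + 1 : ℕ) : ℂ) + 2 = 2 * (m : ℂ) + 3 := by
      push_cast
      ring
  · have hs : (2 * (m : ℤ) + 1).sign = 1 := Int.sign_eq_one_of_pos (by omega)
    have ha : (2 * (m : ℤ) + 1).natAbs = 2 * m + 1 := by omega
    convert (hasPV_unitPhase_zpow m x).deriv_uFun using 2
    rw [hs, ha, hm, pvValue, mul_add (_ / _), mul_add (_ / _), Finset.mul_sum, sub_eq_add_neg, sub_eq_add_neg,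
      ← Finset.sum_neg_distrib]
    congr 1
    · congr 1
      · push_cast
        field_simp
      · push_cast
        field_simp
    · refine Finset.sum_congr (by congr 1; omega) fun n _ => ?_
      rw [show 2 * (m : ℤ) + 1 - 1 * (2 * (n : ℤ) + 1) = 2 * (m : ℤ) - 2 * (n : ℤ) by ring]
      push_cast
      rw [mul_assoc (Real.pi : ℂ), mul_assoc (Real.pi : ℂ), ← div_div]
      ring
  · have hs : (-(2 * (m : ℤ) + 1)).sign = -1 := Int.sign_eq_neg_one_of_neg (by omega)
    have ha : (-(2 * (m : ℤ) + 1)).natAbs = 2 * m + 1 := by omega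
    have hconj : HasPV (fun y => unitPhase y ^ (-(2 * (m : ℤ) + 1)) / ((y : ℂ) ^ 2 + 1)) x
        ((starRingEnd ℂ) (pvValue m x)) := by
      convert (hasPV_unitPhase_zpow m x).conj using 2 with y
      simp [conj_unitPhase]
    convert hconj.deriv_uFun using 2
    rw [hs, ha, hm, pvValue, map_add, map_add, map_sum, mul_add (_ / _), mul_add (_ / _), Finset.mul_sum,
      sub_eq_add_neg, sub_eq_add_neg, ← Finset.sum_neg_distrib]
    congr 1
    · congr 1
      · simp only [map_div₀, map_mul, map_add, map_natCast, map_ofNat, map_one]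
        push_cast
        field_simp
      · simp only [map_div₀, map_mul, map_add, map_pow, map_zpow₀, map_ofNat, map_one,
          Complex.conj_ofReal, conj_unitPhase, inv_zpow']
        push_cast
        field_simp
    · refine Finset.sum_congr (by congr 1; omega) fun n _ => ?_
      simp only [map_div₀, map_mul, map_add, map_sub, map_zpow₀, map_natCast, map_ofNat, map_one,
        conj_unitPhase, inv_zpow']
      rw [show -(2 * (m : ℤ) + 1) - -1 * (2 * (n : ℤ) + 1) = -(2 * (m : ℤ) - 2 * (n : ℤ)) by ring]
      push_cast
      rw [mul_assoc (Real.pi : ℂ), mul_assoc (Real.pi : ℂ), ← div_div]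
      ring
end
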